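/- (Chai, for GL_n) The poset B(GL_n, μ) satisfies: (i) every subset has a join (supremum); (ii) it is ranked, i.e. any two maximal chains between two comparable elements have the same length; (iii) for ν ≤ ν′ in B(GL_n, μ), the common length of any maximal chain from ν to ν′ equals Σ_{i=1}^{n−1} ( ⌊(ν′₁+…+ν′_i) − (μ₁+…+μ_i)⌋ − ⌊(ν₁+…+ν_i) − (μ₁+…+μ_i)⌋ ). -/

import Mathlib

/-!
The poset `B(GL_n, μ)` of Newton vectors: `ν ∈ (ℚⁿ)₊` with `ν ≤ μ` in the dominance
order and satisfying the integrality condition of Newton vectors of isocrystals,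
partially ordered by the dominance order.
-/

noncomputable section

section BGL

variable (n : ℕ)

/-- Partial sum `ν₁ + … + ν_r`. -/
def pSum (ν : Fin n → ℚ) (r : ℕ) : ℚ :=
  ∑ i ∈ Finset.univ.filter (fun i : Fin n => (i : ℕ) < r), ν i

/-- The dominance order on `(ℚⁿ)₊`: `ν ≤ ν'` iff all proper partial sums satisfy `≤`
and the total sums are equal. -/
def DomLE (ν ν' : Fin n → ℚ) : Prop :=
  (∀ r : ℕ, r < n → pSum n ν r ≤ pSum n ν' r) ∧ pSum n ν n = pSum n ν' n

/-- The strict dominance order. -/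
def DomLT (ν ν' : Fin n → ℚ) : Prop := DomLE n ν ν' ∧ ν ≠ ν'

/-- `B(GL_n, μ)`: the set of `ν ∈ (ℚⁿ)₊` (weakly decreasing) with `ν ≤ μ` in the
dominance order, satisfying the integrality condition of Newton vectors:
`ν₁ + … + ν_r ∈ ℤ` whenever `r < n` and `ν_r > ν_{r+1}`, and `ν₁ + … + ν_n ∈ ℤ`. -/
def BGL (μ : Fin n → ℤ) : Set (Fin n → ℚ) :=
  {ν | (∀ i j : Fin n, i ≤ j → ν j ≤ ν i) ∧
    DomLE n ν (fun i => (μ i : ℚ)) ∧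
    (∀ i j : Fin n, (j : ℕ) = (i : ℕ) + 1 → ν j < ν i →
      ∃ z : ℤ, pSum n ν ((i : ℕ) + 1) = (z : ℚ)) ∧
    ∃ z : ℤ, pSum n ν n = (z : ℚ)}

/-- A chain of length `k` in `B(GL_n, μ)` from `a` to `b`. -/
def IsChain' (μ : Fin n → ℤ) (k : ℕ) (c : Fin (k + 1) → (Fin n → ℚ))
    (a b : Fin n → ℚ) : Prop :=
  c 0 = a ∧ c (Fin.last k) = b ∧ (∀ i : Fin (k + 1), c i ∈ BGL n μ) ∧
    ∀ i : Fin k, DomLT n (c i.castSucc) (c i.succ)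

/-- A maximal chain in `B(GL_n, μ)` from `a` to `b`: a chain which admits no
refinement. -/
def IsMaximalChain (μ : Fin n → ℤ) (k : ℕ) (c : Fin (k + 1) → (Fin n → ℚ))
    (a b : Fin n → ℚ) : Prop :=
  IsChain' n μ k c a b ∧
    ∀ i : Fin k, ¬ ∃ z ∈ BGL n μ, DomLT n (c i.castSucc) z ∧ DomLT n z (c i.succ)

end BGL

/-- `H` is the least concave majorant of `f` on `{0, …, n}`. -/
structure IsHull (n : ℕ) (f H : ℕ → ℚ) : Prop where
  le : ∀ r ≤ n, f r ≤ H r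
  zero : H 0 = f 0
  last : H n = f n
  conc : ∀ r, r + 2 ≤ n → H r + H (r + 2) ≤ 2 * H (r + 1)
  brk : ∀ r, r + 2 ≤ n → H r + H (r + 2) = 2 * H (r + 1) ∨ H (r + 1) = f (r + 1)

/-- Recursive construction of the hull, given the slopes. -/
def hullAux (σ : ℕ → ℚ → ℚ) (y : ℚ) : ℕ → ℚ
  | 0 => y
  | r + 1 => hullAux σ y r + σ r (hullAux σ y r)

theorem hull_exists (n : ℕ) (f : ℕ → ℚ) : ∃ H, IsHull n f H := by
  have key : ∀ (r : ℕ) (y : ℚ), ∃ s : ℚ, r < n →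
      (∀ t, r < t → t ≤ n → f t ≤ y + s * ((t : ℚ) - r)) ∧
      ∃ t, r < t ∧ t ≤ n ∧ f t = y + s * ((t : ℚ) - r) := by
    intro r y
    by_cases hr : r < n
    · obtain ⟨t, ht, hmax⟩ := Finset.exists_max_image (Finset.Ioc r n)
        (fun t : ℕ => (f t - y) / ((t : ℚ) - r)) ⟨n, by simp [hr]⟩
      refine ⟨(f t - y) / ((t : ℚ) - r), fun _ => ⟨fun u hu hun => ?_, t, ?_⟩⟩
      · have h1 := hmax u (by simp [hu, hun])
        have hpos : (0 : ℚ) < (u : ℚ) - r := by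
          have : (r : ℚ) < u := by exact_mod_cast hu
          linarith
        rw [div_le_iff₀ hpos] at h1
        linarith
      · rw [Finset.mem_Ioc] at ht
        refine ⟨ht.1, ht.2, ?_⟩
        have hpos : (0 : ℚ) < (t : ℚ) - r := by
          have : (r : ℚ) < t := by exact_mod_cast ht.1
          linarith
        field_simp
        ring
    · exact ⟨0, fun h => absurd h hr⟩
  choose σ hσ using key
  set H := hullAux σ (f 0) with hH
  have step : ∀ r, H (r + 1) = H r + σ r (H r) := fun r => rfl
  have h0 : H 0 = f 0 := rfl
  have hle : ∀ r ≤ n, f r ≤ H r := by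
    intro r hr
    cases r with
    | zero => exact h0.ge
    | succ r =>
      have := (hσ r (H r) hr).1 (r + 1) (by omega) hr
      rw [step]
      push_cast at this
      linarith
  refine ⟨H, hle, h0, ?_, ?_, ?_⟩
  · cases n with
    | zero => exact h0
    | succ m =>
      obtain ⟨t, h1, h2, h3⟩ := (hσ m (H m) (by omega)).2
      obtain rfl : t = m + 1 := by omega
      rw [step, h3]
      push_cast
      ring
  · intro r hr
    obtain ⟨t, h1, h2, h3⟩ := (hσ (r + 1) (H (r + 1)) (by omega)).2
    have h4 := (hσ r (H r) (by omega)).1 t (by omega) h2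
    have hpos : (0 : ℚ) < (t : ℚ) - ((r + 1 : ℕ) : ℚ) := by
      have : ((r + 1 : ℕ) : ℚ) < t := by exact_mod_cast h1
      linarith
    have e2 := step (r + 1)
    have e1 := step r
    have : σ (r + 1) (H (r + 1)) * ((t : ℚ) - ((r + 1 : ℕ) : ℚ)) ≤
        σ r (H r) * ((t : ℚ) - ((r + 1 : ℕ) : ℚ)) := by
      push_cast at *
      nlinarith
    have := le_of_mul_le_mul_right this hpos
    change H (r + 2) = _ at e2
    linarith
  · intro r hr
    obtain ⟨t, h1, h2, h3⟩ := (hσ r (H r) (by omega)).2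
    have e2 := step (r + 1)
    have e1 := step r
    change H (r + 2) = _ at e2
    by_cases ht : t = r + 1
    · right
      subst ht
      rw [h3, e1]
      push_cast
      ring
    · left
      have h1' : r + 1 < t := by omega
      have hpos : (0 : ℚ) < (t : ℚ) - ((r + 1 : ℕ) : ℚ) := by
        have : ((r + 1 : ℕ) : ℚ) < t := by exact_mod_cast h1'
        linarith
      have h4 := (hσ (r + 1) (H (r + 1)) (by omega)).1 t h1' h2
      have : σ r (H r) * ((t : ℚ) - ((r + 1 : ℕ) : ℚ)) ≤
          σ (r + 1) (H (r + 1)) * ((t : ℚ) - ((r + 1 : ℕ) : ℚ)) := by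
        push_cast at *
        nlinarith
      have g1 := le_of_mul_le_mul_right this hpos
      obtain ⟨t, h1, h2, h3⟩ := (hσ (r + 1) (H (r + 1)) (by omega)).2
      have h4 := (hσ r (H r) (by omega)).1 t (by omega) h2
      have hpos : (0 : ℚ) < (t : ℚ) - ((r + 1 : ℕ) : ℚ) := by
        have : ((r + 1 : ℕ) : ℚ) < t := by exact_mod_cast h1
        linarith
      have : σ (r + 1) (H (r + 1)) * ((t : ℚ) - ((r + 1 : ℕ) : ℚ)) ≤
          σ r (H r) * ((t : ℚ) - ((r + 1 : ℕ) : ℚ)) := by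
        push_cast at *
        nlinarith
      have := le_of_mul_le_mul_right this hpos
      linarith

theorem IsHull.compare {n : ℕ} {f H : ℕ → ℚ} (h : IsHull n f H) (G : ℕ → ℚ)
    (hG : ∀ r, r + 2 ≤ n → G r + G (r + 2) ≤ 2 * G (r + 1))
    (hfG : ∀ r ≤ n, f r ≤ G r) : ∀ r ≤ n, H r ≤ G r := by
  by_contra! hcon
  obtain ⟨q, hq, hqG⟩ := hcon
  obtain ⟨m, hm, hmax⟩ := Finset.exists_max_image (Finset.range (n + 1))
    (fun t : ℕ => H t - G t) ⟨n, by simp⟩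
  have hex : ∃ m, m ≤ n ∧ ∀ t ≤ n, H t - G t ≤ H m - G m :=
    ⟨m, by simpa [Nat.lt_succ_iff] using hm,
      fun t ht => hmax t (by simpa [Nat.lt_succ_iff] using ht)⟩
  classical
  obtain ⟨h1, h2⟩ := Nat.find_spec hex
  have hmin : ∀ k, k < Nat.find hex → ¬ _ := fun k hk => Nat.find_min hex hk
  generalize Nat.find hex = s at *
  have hpos : 0 < H s - G s := by have := h2 q hq; linarith
  have hs0 : s ≠ 0 := by
    rintro rfl
    have := hfG 0 (by omega)
    rw [h.zero] at hpos
    linarith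
  have hsn : s ≠ n := by
    rintro rfl
    have := hfG s le_rfl
    rw [h.last] at hpos
    linarith
  obtain ⟨r, rfl⟩ : ∃ r, s = r + 1 := ⟨s - 1, by omega⟩
  have hr : r + 2 ≤ n := by omega
  have hlt : H r - G r < H (r + 1) - G (r + 1) := by
    by_contra! hc
    exact hmin r (by omega) ⟨by omega, fun t ht => (h2 t ht).trans hc⟩
  have h3 := h2 (r + 2) hr
  have h4 := hG r hr
  rcases h.brk r hr with h5 | h5
  · linarith
  · have := hfG (r + 1) (by omega)
    linarith

section
variable {n : ℕ}

theorem pSum_zero (ν : Fin n → ℚ) : pSum n ν 0 = 0 := by simp [pSum]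

theorem pSum_succ (ν : Fin n → ℚ) (r : ℕ) (hr : r < n) :
    pSum n ν (r + 1) = pSum n ν r + ν ⟨r, hr⟩ := by
  unfold pSum
  have : Finset.univ.filter (fun i : Fin n => (i : ℕ) < r + 1) =
      insert ⟨r, hr⟩ (Finset.univ.filter (fun i : Fin n => (i : ℕ) < r)) := by
    ext i
    simp [Fin.ext_iff]
    omega
  rw [this, Finset.sum_insert (by simp)]
  ring

theorem pSum_inj (ν ν' : Fin n → ℚ) (h : ∀ r ≤ n, pSum n ν r = pSum n ν' r) : ν = ν' := by
  funext i
  have h1 := pSum_succ ν i i.2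
  have h2 := pSum_succ ν' i i.2
  have h3 := h i i.2.le
  have h4 := h (i + 1) i.2
  simp only [Fin.eta] at h1 h2
  linarith

theorem DomLE.le {ν ν' : Fin n → ℚ} (h : DomLE n ν ν') : ∀ r ≤ n, pSum n ν r ≤ pSum n ν' r := by
  intro r hr
  rcases hr.lt_or_eq with h1 | rfl
  · exact h.1 r h1
  · exact h.2.le

theorem pSum_conc (ν : Fin n → ℚ) (h : ∀ i j : Fin n, i ≤ j → ν j ≤ ν i) :
    ∀ r, r + 2 ≤ n → pSum n ν r + pSum n ν (r + 2) ≤ 2 * pSum n ν (r + 1) := by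
  intro r hr
  have h1 := pSum_succ ν r (by omega)
  have h2 := pSum_succ ν (r + 1) (by omega)
  have h3 := h ⟨r, by omega⟩ ⟨r + 1, by omega⟩ (by simp)
  change pSum n ν (r + 2) = _ at h2
  linarith

theorem pSum_int (μ : Fin n → ℤ) (r : ℕ) :
    ∃ z : ℤ, pSum n (fun i => (μ i : ℚ)) r = z :=
  ⟨∑ i ∈ Finset.univ.filter (fun i : Fin n => (i : ℕ) < r), μ i, by simp [pSum]⟩

theorem BGL_hull {μ : Fin n → ℤ} {ν : Fin n → ℚ} (h : ν ∈ BGL n μ) :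
    IsHull n (fun r => ((⌊pSum n ν r⌋ : ℤ) : ℚ)) (pSum n ν) := by
  obtain ⟨h1, h2, h3, z, hz⟩ := h
  refine ⟨fun r _ => Int.floor_le _, by simp [pSum_zero], by simp [hz], pSum_conc ν h1, ?_⟩
  intro r hr
  have e1 := pSum_succ ν r (by omega)
  have e2 := pSum_succ ν (r + 1) (by omega)
  change pSum n ν (r + 2) = _ at e2
  rcases (h1 ⟨r, by omega⟩ ⟨r + 1, by omega⟩ (by simp)).lt_or_eq with h | h
  · right
    obtain ⟨w, hw⟩ := h3 ⟨r, by omega⟩ ⟨r + 1, by omega⟩ rfl h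
    simp only at hw
    simp [hw]
  · left
    linarith

theorem BGL_of_hull (μ : Fin n → ℤ) (hμ : ∀ i j : Fin n, i ≤ j → μ j ≤ μ i) (f : ℕ → ℤ)
    (h0 : f 0 = 0) (hn : (f n : ℚ) = pSum n (fun i => (μ i : ℚ)) n)
    (hle : ∀ r ≤ n, (f r : ℚ) ≤ pSum n (fun i => (μ i : ℚ)) r) :
    ∃ ν ∈ BGL n μ, IsHull n (fun r => (f r : ℚ)) (pSum n ν) := by
  obtain ⟨H, hH⟩ := hull_exists n (fun r => (f r : ℚ))
  have hHM := hH.compare _ (pSum_conc (fun i => (μ i : ℚ))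
    (fun i j hij => by exact_mod_cast hμ i j hij)) hle
  set ν : Fin n → ℚ := fun i => H (i + 1) - H i with hν
  have hp : ∀ r ≤ n, pSum n ν r = H r := by
    intro r
    induction r with
    | zero => intro _; rw [pSum_zero, hH.zero]; simp [h0]
    | succ r ih =>
      intro hr
      rw [pSum_succ ν r hr, ih (by omega)]
      simp [hν]
  refine ⟨ν, ⟨?_, ⟨?_, ?_⟩, ?_, f n, ?_⟩, ?_⟩
  · have anti : ∀ d i : ℕ, i + d + 1 ≤ n → H (i + d + 1) - H (i + d) ≤ H (i + 1) - H i := by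
      intro d
      induction d with
      | zero => intro i _; simp
      | succ d ih =>
        intro i hi
        have a := ih i (by omega)
        have b := hH.conc (i + d) (by omega)
        change H (i + d + 2) - H (i + d + 1) ≤ _
        linarith
    intro i j hij
    have hij' : (i : ℕ) ≤ j := hij
    obtain ⟨d, hd⟩ := Nat.exists_eq_add_of_le hij'
    have := anti d i (by have := j.2; omega)
    simp only [hν]
    rw [hd]
    exact this
  · intro r hr
    rw [hp r hr.le]
    exact hHM r hr.le
  · rw [hp n le_rfl, hH.last]
    exact hn
  · intro i j hij hlt
    have hj := j.2
    rw [hp _ (by omega)]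
    rcases hH.brk i (by omega) with h | h
    · simp only [hν, hij] at hlt
      change H (i + 2) - H (i + 1) < _ at hlt
      linarith
    · exact ⟨_, h⟩
  · rw [hp n le_rfl, hH.last]
  · refine ⟨?_, ?_, ?_, ?_, ?_⟩
    · intro r hr
      rw [hp r hr]
      exact hH.le r hr
    · rw [hp 0 (by omega)]
      exact hH.zero
    · rw [hp n le_rfl]
      exact hH.last
    · intro r hr
      rw [hp r (by omega), hp (r + 1) (by omega), hp (r + 2) hr]
      exact hH.conc r hr
    · intro r hr
      rw [hp r (by omega), hp (r + 1) (by omega), hp (r + 2) hr]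
      exact hH.brk r hr

/-- The rank function. -/
def rk (n : ℕ) (ν : Fin n → ℚ) : ℤ := ∑ r ∈ Finset.Ico 1 n, ⌊pSum n ν r⌋

theorem cover_rk (μ : Fin n → ℤ) (hμ : ∀ i j : Fin n, i ≤ j → μ j ≤ μ i)
    (a b : Fin n → ℚ) (ha : a ∈ BGL n μ) (hb : b ∈ BGL n μ) (hab : DomLT n a b)
    (hno : ¬ ∃ z ∈ BGL n μ, DomLT n a z ∧ DomLT n z b) : rk n b = rk n a + 1 := by
  have Hb := BGL_hull hb
  have Ha := BGL_hull ha
  have hle := hab.1.le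
  -- a strict break point of `b` where `a < b`
  have hex : ∃ r, r + 2 ≤ n ∧ pSum n b r + pSum n b (r + 2) < 2 * pSum n b (r + 1) ∧
      pSum n a (r + 1) < pSum n b (r + 1) := by
    by_contra! hc
    have hh : IsHull n (pSum n a) (pSum n b) := by
      refine ⟨hle, by simp [pSum_zero], hab.1.2.symm, Hb.conc, ?_⟩
      intro r hr
      rcases (Hb.conc r hr).lt_or_eq with h | h
      · exact Or.inr (le_antisymm (hc r hr h) (hle _ (by omega)))
      · exact Or.inl h
    exact hab.2 (pSum_inj a b fun r hr =>
      le_antisymm (hle r hr) (hh.compare _ Ha.conc (fun _ _ => le_rfl) r hr))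
  obtain ⟨r, hr, hbr, hlt⟩ := hex
  have hbi : pSum n b (r + 1) = ⌊pSum n b (r + 1)⌋ := by
    rcases Hb.brk r hr with h | h
    · linarith
    · exact h
  set f : ℕ → ℤ := fun t => if t = r + 1 then ⌊pSum n b t⌋ - 1 else ⌊pSum n b t⌋ with hf
  have hf1 : f (r + 1) = ⌊pSum n b (r + 1)⌋ - 1 := by simp [hf]
  have hf2 : ∀ t, t ≠ r + 1 → f t = ⌊pSum n b t⌋ := fun t ht => by simp [hf, ht]
  have hfb : ∀ t, (f t : ℚ) ≤ pSum n b t := by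
    intro t
    have h1 : f t ≤ ⌊pSum n b t⌋ := by simp only [hf]; split_ifs <;> omega
    exact (by exact_mod_cast h1 : (f t : ℚ) ≤ ⌊pSum n b t⌋).trans (Int.floor_le _)
  have hfa : ∀ t ≤ n, ((⌊pSum n a t⌋ : ℤ) : ℚ) ≤ f t := by
    intro t ht
    by_cases h : t = r + 1
    · subst h
      rw [hf1]
      have : ((⌊pSum n a (r + 1)⌋ : ℤ) : ℚ) < ⌊pSum n b (r + 1)⌋ := by
        rw [← hbi]
        exact (Int.floor_le _).trans_lt hlt
      have : ⌊pSum n a (r + 1)⌋ < ⌊pSum n b (r + 1)⌋ := by exact_mod_cast this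
      exact_mod_cast (by omega : ⌊pSum n a (r + 1)⌋ ≤ ⌊pSum n b (r + 1)⌋ - 1)
    · rw [hf2 t h]
      exact_mod_cast Int.floor_le_floor (hle t ht)
  obtain ⟨ν, hν, hH⟩ := BGL_of_hull μ hμ f (by rw [hf2 0 (by omega)]; simp [pSum_zero])
    (by rw [hf2 n (by omega), ← hb.2.1.2]; exact Hb.last.symm)
    (fun t ht => (hfb t).trans (hb.2.1.le t ht))
  have hνb := hH.compare _ Hb.conc (fun t _ => hfb t)
  have haν := Ha.compare _ hH.conc (fun t ht => (hfa t ht).trans (hH.le t ht))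
  have hνr : pSum n ν (r + 1) < pSum n b (r + 1) := by
    rcases (hνb (r + 1) (by omega)).lt_or_eq with h | h
    · exact h
    · rcases hH.brk r hr with h' | h'
      · have := hνb r (by omega)
        have := hνb (r + 2) (by omega)
        linarith
      · simp only [hf1] at h'
        push_cast at h'
        linarith
  have hνtot : pSum n ν n = pSum n b n := hν.2.1.2.trans hb.2.1.2.symm
  have hνa : a = ν := by
    by_contra hne
    refine hno ⟨ν, hν, ⟨⟨fun t ht => haν t ht.le, hab.1.2.trans hνtot.symm⟩, hne⟩,
      ⟨fun t ht => hνb t ht.le, hνtot⟩, ?_⟩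
    rintro rfl
    exact lt_irrefl _ hνr
  have hfl : ∀ t ≤ n, ⌊pSum n ν t⌋ = f t := by
    intro t ht
    apply le_antisymm
    · by_cases h : t = r + 1
      · subst h
        rw [hf1]
        have : ((⌊pSum n ν (r + 1)⌋ : ℤ) : ℚ) < ⌊pSum n b (r + 1)⌋ := by
          rw [← hbi]
          exact (Int.floor_le _).trans_lt hνr
        have : ⌊pSum n ν (r + 1)⌋ < ⌊pSum n b (r + 1)⌋ := by exact_mod_cast this
        omega
      · rw [hf2 t h]
        exact Int.floor_le_floor (hνb t ht)
    · exact Int.le_floor.2 (hH.le t ht)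
  rw [hνa]
  unfold rk
  have hmem : r + 1 ∈ Finset.Ico 1 n := by simp; omega
  rw [← Finset.add_sum_erase _ _ hmem, ← Finset.add_sum_erase (Finset.Ico 1 n) _ hmem,
    hfl _ (by omega), hf1]
  have : ∑ x ∈ (Finset.Ico 1 n).erase (r + 1), ⌊pSum n ν x⌋ =
      ∑ x ∈ (Finset.Ico 1 n).erase (r + 1), ⌊pSum n b x⌋ := by
    apply Finset.sum_congr rfl
    intro x hx
    simp only [Finset.mem_erase, Finset.mem_Ico] at hx
    rw [hfl x (by omega), hf2 x hx.1]
  rw [this]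
  ring

theorem chain_rk (μ : Fin n → ℤ) (hμ : ∀ i j : Fin n, i ≤ j → μ j ≤ μ i)
    (a b : Fin n → ℚ) (k : ℕ) (c : Fin (k + 1) → (Fin n → ℚ))
    (hc : IsMaximalChain n μ k c a b) : (k : ℤ) = rk n b - rk n a := by
  obtain ⟨⟨h0, hl, hm, hlt⟩, hno⟩ := hc
  have : ∀ i : Fin (k + 1), rk n (c i) = rk n a + (i : ℕ) := by
    intro i
    induction i using Fin.induction with
    | zero => simp [h0]
    | succ i ih =>
      rw [cover_rk μ hμ _ _ (hm _) (hm _) (hlt i) (hno i), ih]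
      simp
      ring
  have h := this (Fin.last k)
  rw [hl] at h
  simp at h
  omega

theorem rk_sub (μ : Fin n → ℤ) (a b : Fin n → ℚ) :
    rk n b - rk n a = ∑ r ∈ Finset.Ico 1 n,
          (⌊pSum n b r - pSum n (fun i => (μ i : ℚ)) r⌋ -
            ⌊pSum n a r - pSum n (fun i => (μ i : ℚ)) r⌋) := by
  unfold rk
  rw [← Finset.sum_sub_distrib]
  apply Finset.sum_congr rfl
  intro r _
  obtain ⟨z, hz⟩ := pSum_int μ r
  rw [hz, Int.floor_sub_intCast, Int.floor_sub_intCast]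
  ring

theorem conc_chord (G : ℕ → ℚ) (d : ℚ) (h0 : G 0 = 0) (hn : G n = d)
    (hG : ∀ r, r + 2 ≤ n → G r + G (r + 2) ≤ 2 * G (r + 1)) :
    ∀ r ≤ n, (r : ℚ) * d / n ≤ G r := by
  have hh : IsHull n (fun r => if r = 0 ∨ r = n then (r : ℚ) * d / n else G r ⊓ ((r : ℚ) * d / n))
      (fun r => (r : ℚ) * d / n) := by
    refine ⟨?_, by simp, by simp, ?_, ?_⟩
    · intro r _
      split_ifs
      · exact le_rfl
      · exact inf_le_right
    · intro r _
      push_cast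
      apply le_of_eq
      ring
    · intro r _
      left
      push_cast
      ring
  refine hh.compare G hG ?_
  intro r hr
  split_ifs with h
  · rcases h with rfl | rfl
    · simp [h0]
    · by_cases hr0 : r = 0
      · subst hr0; simp [h0]
      · have : (r : ℚ) ≠ 0 := by exact_mod_cast hr0
        rw [hn]
        field_simp
        exact le_rfl
  · exact inf_le_left

theorem join_exists (μ : Fin n → ℤ) (hμ : ∀ i j : Fin n, i ≤ j → μ j ≤ μ i)
    (S : Set (Fin n → ℚ)) (hS : S ⊆ BGL n μ) : ∃ j ∈ BGL n μ,
      (∀ x ∈ S, DomLE n x j) ∧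
      ∀ u ∈ BGL n μ, (∀ x ∈ S, DomLE n x u) → DomLE n j u := by
  set M := pSum n (fun i => (μ i : ℚ)) with hM
  have hMc : ∀ r, r + 2 ≤ n → M r + M (r + 2) ≤ 2 * M (r + 1) :=
    pSum_conc _ (fun i j hij => by exact_mod_cast hμ i j hij)
  have hM0 : M 0 = 0 := pSum_zero _
  set T : ℕ → Set ℤ := fun r => {z | z = ⌊(r : ℚ) * M n / n⌋ ∨ ∃ x ∈ S, z = ⌊pSum n x r⌋} with hT
  have hne : ∀ r, (T r).Nonempty := fun r => ⟨_, Or.inl rfl⟩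
  -- upper bounds
  have hub : ∀ G : ℕ → ℚ, G 0 = 0 → G n = M n →
      (∀ r, r + 2 ≤ n → G r + G (r + 2) ≤ 2 * G (r + 1)) →
      (∀ x ∈ S, ∀ r ≤ n, pSum n x r ≤ G r) → ∀ r ≤ n, ∀ z ∈ T r, z ≤ ⌊G r⌋ := by
    intro G h0 hn hG hx r hr z hz
    rcases hz with rfl | ⟨x, hxS, rfl⟩
    · exact Int.floor_le_floor (conc_chord G (M n) h0 hn hG r hr)
    · exact Int.floor_le_floor (hx x hxS r hr)
  have hubM := hub M hM0 rfl hMc (fun x hx => (hS hx).2.1.le)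
  set f : ℕ → ℤ := fun r => sSup (T r) with hf
  have hmem : ∀ r ≤ n, f r ∈ T r := fun r hr => Int.csSup_mem (hne r) ⟨_, hubM r hr⟩
  have hfle : ∀ r ≤ n, ∀ z ∈ T r, z ≤ f r := fun r hr z hz => le_csSup ⟨_, hubM r hr⟩ hz
  have hfG : ∀ G : ℕ → ℚ, G 0 = 0 → G n = M n →
      (∀ r, r + 2 ≤ n → G r + G (r + 2) ≤ 2 * G (r + 1)) →
      (∀ x ∈ S, ∀ r ≤ n, pSum n x r ≤ G r) → ∀ r ≤ n, (f r : ℚ) ≤ G r := by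
    intro G h0 hn hG hx r hr
    exact Int.le_floor.1 (hub G h0 hn hG hx r hr _ (hmem r hr))
  have hfM := hfG M hM0 rfl hMc (fun x hx => (hS hx).2.1.le)
  obtain ⟨z, hz⟩ := pSum_int μ n
  have hMn : M n = z := hz
  obtain ⟨ν, hν, hH⟩ := BGL_of_hull μ hμ f
    (by
      rcases hmem 0 (by omega) with h | ⟨x, _, h⟩
      · rw [h]; simp
      · rw [h]; simp [pSum_zero])
    (by
      change _ = M n
      rcases hmem n le_rfl with h | ⟨x, hx, h⟩
      · by_cases hn : n = 0
        · rw [h]; subst hn; simp [hM0]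
        · have : (n : ℚ) ≠ 0 := by exact_mod_cast hn
          rw [h, mul_div_assoc, mul_div_cancel₀ _ this, hMn]
          simp
      · rw [h, (hS hx).2.1.2]
        change ((⌊M n⌋ : ℤ) : ℚ) = M n
        rw [hMn]
        simp)
    hfM
  refine ⟨ν, hν, ?_, ?_⟩
  · intro x hx
    have h := (BGL_hull (hS hx)).compare _ hH.conc (fun t ht => by
      refine le_trans ?_ (hH.le t ht)
      exact_mod_cast hfle t ht _ (Or.inr ⟨x, hx, rfl⟩))
    exact ⟨fun r hr => h r hr.le, (hS hx).2.1.2.trans hν.2.1.2.symm⟩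
  · intro u hu hxu
    have h := hH.compare _ (pSum_conc u hu.1)
      (hfG _ (pSum_zero u) hu.2.1.2 (pSum_conc u hu.1) (fun x hx => (hxu x hx).le))
    exact ⟨fun r hr => h r hr.le, hν.2.1.2.trans hu.2.1.2.symm⟩

end

/-- Chai, for `GL_n`. The poset `B(GL_n, μ)` satisfies:
(i) every subset has a join (supremum);
(ii) it is ranked, i.e. any two maximal chains between two comparable elements have the
same length;
(iii) for `ν ≤ ν′` in `B(GL_n, μ)`, the common length of any maximal chain from `ν` to
`ν′` equals `Σ_{i=1}^{n−1} (⌊(ν′₁+…+ν′_i) − (μ₁+…+μ_i)⌋ − ⌊(ν₁+…+ν_i) − (μ₁+…+μ_i)⌋)`. -/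
theorem BGL_poset_properties (n : ℕ) (μ : Fin n → ℤ)
    (hμ : ∀ i j : Fin n, i ≤ j → μ j ≤ μ i) :
    (∀ S ⊆ BGL n μ, ∃ j ∈ BGL n μ,
      (∀ x ∈ S, DomLE n x j) ∧
      ∀ u ∈ BGL n μ, (∀ x ∈ S, DomLE n x u) → DomLE n j u) ∧
    (∀ (a b : Fin n → ℚ), a ∈ BGL n μ → b ∈ BGL n μ → DomLE n a b →
      ∀ (kk kk' : ℕ) (c : Fin (kk + 1) → (Fin n → ℚ)) (c' : Fin (kk' + 1) → (Fin n → ℚ)),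
        IsMaximalChain n μ kk c a b → IsMaximalChain n μ kk' c' a b → kk = kk') ∧
    (∀ (a b : Fin n → ℚ), a ∈ BGL n μ → b ∈ BGL n μ → DomLE n a b →
      ∀ (kk : ℕ) (c : Fin (kk + 1) → (Fin n → ℚ)), IsMaximalChain n μ kk c a b →
        (kk : ℤ) = ∑ r ∈ Finset.Ico 1 n,
          (⌊pSum n b r - pSum n (fun i => (μ i : ℚ)) r⌋ -
            ⌊pSum n a r - pSum n (fun i => (μ i : ℚ)) r⌋)) := by
  refine ⟨join_exists μ hμ, ?_, ?_⟩
  · intro a b _ _ _ kk kk' c c' hc hc'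
    have h1 := chain_rk μ hμ a b kk c hc
    have h2 := chain_rk μ hμ a b kk' c' hc'
    omega
  · intro a b _ _ _ kk c hc
    rw [chain_rk μ hμ a b kk c hc, rk_sub μ]
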